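/- The abelianization of Λ := C⟨x,y⟩/(xy+yx, x³-y²) is isomorphic as a C-algebra to the commutative ring C[x,y]/(xy, x²+y³), and in particular is 5-dimensional over C. -/

import Mathlib

open FreeAlgebra

/-- The relations defining Λ = C⟨x,y⟩/(xy+yx, x³-y²), with x = ι ℂ 0 and y = ι ℂ 1. -/
inductive LamRel : FreeAlgebra ℂ (Fin 2) → FreeAlgebra ℂ (Fin 2) → Prop
  | r1 : LamRel (ι ℂ 0 * ι ℂ 1 + ι ℂ 1 * ι ℂ 0) 0
  | r2 : LamRel ((ι ℂ 0) ^ 3 - (ι ℂ 1) ^ 2) 0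

noncomputable abbrev Lam := RingQuot LamRel

/-- The commutator relation: abelianization is the quotient by the two-sided ideal
generated by all commutators, i.e. the ring quotient identifying `u * v` with `v * u`. -/
inductive CommRel : Lam → Lam → Prop
  | comm (u v : Lam) : CommRel (u * v) (v * u)

/-- The abelianization of Λ. -/
noncomputable abbrev LamAb := RingQuot CommRel

/-- The projection from the free algebra onto the abelianization of Λ. -/
noncomputable def lamAbMk : FreeAlgebra ℂ (Fin 2) →ₐ[ℂ] LamAb :=
  (RingQuot.mkAlgHom ℂ CommRel).comp (RingQuot.mkAlgHom ℂ LamRel)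

theorem lamAbMk_surjective : Function.Surjective lamAbMk :=
  (RingQuot.mkAlgHom_surjective ℂ CommRel).comp (RingQuot.mkAlgHom_surjective ℂ LamRel)

theorem lamAbMk_eq_zero_of_lamRel {u : FreeAlgebra ℂ (Fin 2)} (h : LamRel u 0) :
    lamAbMk u = 0 := by
  rw [lamAbMk, AlgHom.comp_apply, RingQuot.mkAlgHom_rel ℂ h, map_zero, map_zero]

theorem lamAbMk_mul_comm (u v : FreeAlgebra ℂ (Fin 2)) :
    lamAbMk u * lamAbMk v = lamAbMk v * lamAbMk u := by
  have h := RingQuot.mkAlgHom_rel ℂ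
    (CommRel.comm (RingQuot.mkAlgHom ℂ LamRel u) (RingQuot.mkAlgHom ℂ LamRel v))
  rwa [map_mul, map_mul] at h

theorem lamAbMk_mul_eq_zero : lamAbMk (ι ℂ 0) * lamAbMk (ι ℂ 1) = 0 := by
  have h := lamAbMk_eq_zero_of_lamRel LamRel.r1
  rw [map_add, map_mul, map_mul, lamAbMk_mul_comm (ι ℂ 1), ← two_smul ℂ] at h
  exact (smul_eq_zero.mp h).resolve_left two_ne_zero

theorem lamAbMk_pow_three : lamAbMk (ι ℂ 0) ^ 3 = lamAbMk (ι ℂ 1) ^ 2 := by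
  have h := lamAbMk_eq_zero_of_lamRel LamRel.r2
  rwa [map_sub, map_pow, map_pow, sub_eq_zero] at h

/-- The spanning family `1, x, y, x², x³` of the abelianization of Λ. -/
noncomputable def lamAbFamily : Fin 5 → LamAb :=
  ![1, lamAbMk (ι ℂ 0), lamAbMk (ι ℂ 1), lamAbMk (ι ℂ 0) ^ 2, lamAbMk (ι ℂ 0) ^ 3]

theorem lamAbMk_ι_mul_lamAbFamily_mem (i : Fin 2) (j : Fin 5) :
    lamAbMk (ι ℂ i) * lamAbFamily j ∈ Submodule.span ℂ (Set.range lamAbFamily) := by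
  have mem (k : Fin 5) : lamAbFamily k ∈ Submodule.span ℂ (Set.range lamAbFamily) :=
    Submodule.subset_span ⟨k, rfl⟩
  have h01 := lamAbMk_mul_eq_zero
  have h10 : lamAbMk (ι ℂ 1) * lamAbMk (ι ℂ 0) = 0 := by rw [lamAbMk_mul_comm, h01]
  have h3 := lamAbMk_pow_three
  have of_eq {z : LamAb} (k : Fin 5) (h : z = lamAbFamily k) :
      z ∈ Submodule.span ℂ (Set.range lamAbFamily) := h ▸ mem k
  have of_zero {z : LamAb} (h : z = 0) :
      z ∈ Submodule.span ℂ (Set.range lamAbFamily) := h ▸ Submodule.zero_mem _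
  fin_cases i <;> fin_cases j
  · exact of_eq 1 (mul_one _)
  · exact of_eq 3 (pow_two _).symm
  · exact of_zero h01
  · exact of_eq 4 (pow_succ' _ _).symm
  · refine of_zero ?_
    change lamAbMk (ι ℂ 0) * lamAbMk (ι ℂ 0) ^ 3 = 0
    rw [h3, pow_two, ← mul_assoc, h01, zero_mul]
  · exact of_eq 2 (mul_one _)
  · exact of_zero h10
  · exact of_eq 4 ((pow_two _).symm.trans h3.symm)
  · refine of_zero ?_
    change lamAbMk (ι ℂ 1) * lamAbMk (ι ℂ 0) ^ 2 = 0
    rw [pow_two, ← mul_assoc, h10, zero_mul]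
  · refine of_zero ?_
    change lamAbMk (ι ℂ 1) * lamAbMk (ι ℂ 0) ^ 3 = 0
    rw [pow_succ', ← mul_assoc, h10, zero_mul]

theorem lamAbMk_mul_mem_span (u : FreeAlgebra ℂ (Fin 2)) :
    ∀ s ∈ Submodule.span ℂ (Set.range lamAbFamily),
      lamAbMk u * s ∈ Submodule.span ℂ (Set.range lamAbFamily) := by
  induction u using FreeAlgebra.induction with
  | grade0 r =>
    intro s hs
    rw [AlgHom.commutes, ← Algebra.smul_def]
    exact Submodule.smul_mem _ _ hs
  | grade1 i =>
    intro s hs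
    induction hs using Submodule.span_induction with
    | mem s hs =>
      obtain ⟨j, rfl⟩ := hs
      exact lamAbMk_ι_mul_lamAbFamily_mem i j
    | zero => simp
    | add s t _ _ hs ht => rw [mul_add]; exact Submodule.add_mem _ hs ht
    | smul c s _ hs => rw [mul_smul_comm]; exact Submodule.smul_mem _ _ hs
  | mul a b ha hb => intro s hs; rw [map_mul, mul_assoc]; exact ha _ (hb _ hs)
  | add a b ha hb =>
    intro s hs
    rw [map_add, add_mul]
    exact Submodule.add_mem _ (ha _ hs) (hb _ hs)

theorem span_lamAbFamily : Submodule.span ℂ (Set.range lamAbFamily) = ⊤ := by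
  refine Submodule.eq_top_iff'.mpr fun z => ?_
  obtain ⟨u, rfl⟩ := lamAbMk_surjective z
  simpa using lamAbMk_mul_mem_span u 1 (Submodule.subset_span ⟨0, rfl⟩)

open MvPolynomial in
/-- The ideal `(xy, x² + y³)` of `ℂ[x, y]`. -/
noncomputable abbrev abIdeal : Ideal (MvPolynomial (Fin 2) ℂ) :=
  Ideal.span {(X 0 * X 1 : MvPolynomial (Fin 2) ℂ), X 0 ^ 2 + X 1 ^ 3}

open MvPolynomial in
/-- The homomorphism from the abelianization of Λ to `ℂ[x, y]/(xy, x² + y³)`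
sending `x` to `-y` and `y` to `x`. -/
noncomputable def lamAbHom : LamAb →ₐ[ℂ] MvPolynomial (Fin 2) ℂ ⧸ abIdeal :=
  RingQuot.liftAlgHom ℂ ⟨RingQuot.liftAlgHom ℂ
    ⟨(Ideal.Quotient.mkₐ ℂ abIdeal).comp (FreeAlgebra.lift ℂ ![-X 1, X 0]), by
      have h1 : (X 0 * X 1 : MvPolynomial (Fin 2) ℂ) ∈ abIdeal :=
        Ideal.subset_span (by simp)
      have h2 : (X 0 ^ 2 + X 1 ^ 3 : MvPolynomial (Fin 2) ℂ) ∈ abIdeal :=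
        Ideal.subset_span (by simp)
      intro u v h
      rw [AlgHom.comp_apply, AlgHom.comp_apply]
      refine Ideal.Quotient.eq.mpr ?_
      cases h with
      | r1 =>
        convert abIdeal.mul_mem_left (-2) h1 using 1
        simp only [map_add, map_mul, map_zero, FreeAlgebra.lift_ι_apply, Matrix.cons_val_zero,
          Matrix.cons_val_one]
        ring
      | r2 =>
        convert abIdeal.neg_mem h2 using 1
        simp only [map_sub, map_pow, map_zero, FreeAlgebra.lift_ι_apply, Matrix.cons_val_zero,
          Matrix.cons_val_one]
        ring⟩, by
    rintro _ _ ⟨u, v⟩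
    exact (map_mul _ u v).trans ((mul_comm _ _).trans (map_mul _ v u).symm)⟩

open MvPolynomial in
theorem lamAbHom_lamAbMk (u : FreeAlgebra ℂ (Fin 2)) :
    lamAbHom (lamAbMk u) = Ideal.Quotient.mk abIdeal (FreeAlgebra.lift ℂ ![-X 1, X 0] u) := by
  simp only [lamAbHom, lamAbMk, AlgHom.comp_apply, RingQuot.liftAlgHom_mkAlgHom_apply]
  rfl

open MvPolynomial in
theorem lamAbHom_surjective : Function.Surjective lamAbHom := by
  intro z
  obtain ⟨p, rfl⟩ := Ideal.Quotient.mk_surjective z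
  change Ideal.Quotient.mk abIdeal p ∈ lamAbHom.range
  induction p using MvPolynomial.induction_on with
  | C a => exact lamAbHom.range.algebraMap_mem a
  | add p q hp hq => rw [map_add]; exact add_mem hp hq
  | mul_X p i hp =>
    rw [map_mul]
    refine mul_mem hp ?_
    fin_cases i
    · exact ⟨lamAbMk (ι ℂ 1), by simp [lamAbHom_lamAbMk]⟩
    · exact ⟨lamAbMk (-ι ℂ 0), by simp [lamAbHom_lamAbMk, -map_neg, map_neg (FreeAlgebra.lift ℂ _)]⟩

open MvPolynomial Finsupp in
/-- Coordinates of a polynomial modulo `(xy, x² + y³)` in the basis `1, x, y, y², y³`. -/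
noncomputable def abCoordAux : MvPolynomial (Fin 2) ℂ →ₗ[ℂ] Fin 5 → ℂ :=
  LinearMap.pi ![lcoeff ℂ 0, lcoeff ℂ (single 0 1), lcoeff ℂ (single 1 1), lcoeff ℂ (single 1 2),
    lcoeff ℂ (single 1 3) - lcoeff ℂ (single 0 2)]

open MvPolynomial Finsupp in
theorem abCoordAux_eq_zero {p : MvPolynomial (Fin 2) ℂ} (hp : p ∈ abIdeal) :
    abCoordAux p = 0 := by
  obtain ⟨a, b, rfl⟩ := Ideal.mem_span_pair.mp hp
  have e1 : a * (X 0 * X 1) = a * monomial (single 0 1 + single 1 1) 1 := by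
    simp only [X, monomial_mul, one_mul]
  rw [mul_add, e1, X_pow_eq_monomial, X_pow_eq_monomial]
  funext i
  fin_cases i <;>
    simp [abCoordAux, coeff_mul_monomial', Finsupp.le_def, Fin.forall_fin_two, Finsupp.single_apply]

/-- Coordinates on `ℂ[x, y]/(xy, x² + y³)` in the basis `1, x, y, y², y³`. -/
noncomputable def abCoord : (MvPolynomial (Fin 2) ℂ ⧸ abIdeal) →ₗ[ℂ] Fin 5 → ℂ :=
  (abIdeal.restrictScalars ℂ).liftQ abCoordAux fun _ hp => abCoordAux_eq_zero hp

open MvPolynomial Finsupp in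
theorem abCoord_surjective : Function.Surjective abCoord := by
  intro v
  refine ⟨Ideal.Quotient.mk abIdeal (monomial 0 (v 0) + monomial (single 0 1) (v 1) +
    monomial (single 1 1) (v 2) + monomial (single 1 2) (v 3) + monomial (single 1 3) (v 4)), ?_⟩
  change abCoordAux _ = v
  funext i
  fin_cases i <;> simp [abCoordAux, coeff_monomial, Finsupp.ext_iff, Fin.forall_fin_two,
    Finsupp.single_apply]

theorem abCoord_comp_lamAbHom_surjective :
    Function.Surjective (abCoord ∘ₗ lamAbHom.toLinearMap) :=
  abCoord_surjective.comp lamAbHom_surjective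

instance : Module.Finite ℂ LamAb :=
  ⟨⟨(Set.finite_range lamAbFamily).toFinset, by
    rw [Set.Finite.coe_toFinset, span_lamAbFamily]⟩⟩

theorem finrank_lamAb : Module.finrank ℂ LamAb = 5 := by
  apply le_antisymm
  · have h := finrank_range_le_card (R := ℂ) lamAbFamily
    rwa [Set.finrank, span_lamAbFamily, finrank_top, Fintype.card_fin] at h
  · simpa using LinearMap.finrank_le_finrank_of_surjective abCoord_comp_lamAbHom_surjective

theorem lamAbHom_injective : Function.Injective lamAbHom := by
  have h : Function.Injective (abCoord ∘ₗ lamAbHom.toLinearMap) :=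
    (LinearMap.injective_iff_surjective_of_finrank_eq_finrank (V := LamAb) (V₂ := Fin 5 → ℂ)
      (finrank_lamAb.trans (Module.finrank_fin_fun ℂ).symm)).mpr abCoord_comp_lamAbHom_surjective
  exact Function.Injective.of_comp h

theorem stmt8 :
    Nonempty (LamAb ≃ₐ[ℂ]
      (MvPolynomial (Fin 2) ℂ ⧸
        Ideal.span {(MvPolynomial.X 0 * MvPolynomial.X 1 : MvPolynomial (Fin 2) ℂ),
          MvPolynomial.X 0 ^ 2 + MvPolynomial.X 1 ^ 3})) ∧
    Module.finrank ℂ LamAb = 5 :=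
  ⟨⟨AlgEquiv.ofBijective lamAbHom ⟨lamAbHom_injective, lamAbHom_surjective⟩⟩, finrank_lamAb⟩
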